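/- For every n of the form 2^k − 1 with n ≥ 15, there exists a reduced perfect binary code of length n that is transitive but not propelinear. -/

import Mathlib

set_option linter.unusedSectionVars false

/-- Binary vectors of length `|ι|`, indexed by `ι`. -/
abbrev F (ι : Type*) : Type _ := ι → ZMod 2

section Defs

variable {ι : Type*}

/-- The support of a vector: the set of its nonzero coordinate positions. -/
def supp (x : F ι) : Set ι := {i | x i ≠ 0}

/-- Action of a permutation on binary vectors by permuting coordinates:
`(permAct π x) (π i) = x i`. -/
def permAct (π : Equiv.Perm ι) (x : F ι) : F ι := x ∘ π.symm

/-- The image `π(C)` of a code under a coordinate permutation. -/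
def permCode (π : Equiv.Perm ι) (C : Set (F ι)) : Set (F ι) := permAct π '' C

/-- The translateCode `y + C` of a code. -/
def translateCode (y : F ι) (C : Set (F ι)) : Set (F ι) := (y + ·) '' C

/-- `Sym(C) = {π : π(C) = C}`. -/
def SymSet (C : Set (F ι)) : Set (Equiv.Perm ι) := {π | permCode π C = C}

/-- `Rot(C) = {π : ∃ y ∈ C, y + π(C) = C}`. -/
def RotSet (C : Set (F ι)) : Set (Equiv.Perm ι) :=
  {π | ∃ y ∈ C, translateCode y (permCode π C) = C}

/-- `Rot_y(C) = {π : y + π(C) = C}`. -/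
def RotAt (C : Set (F ι)) (y : F ι) : Set (Equiv.Perm ι) :=
  {π | translateCode y (permCode π C) = C}

/-- `Tr(C) = {y ∈ C : ∃ π, y + π(C) = C}`. -/
def TrSet (C : Set (F ι)) : Set (F ι) :=
  {y | y ∈ C ∧ ∃ π : Equiv.Perm ι, translateCode y (permCode π C) = C}

/-- `Ker(C) = {x ∈ C : x + C = C}`. -/
def KerSet (C : Set (F ι)) : Set (F ι) := {x | x ∈ C ∧ translateCode x C = C}

/-- `Aut(C) = {(y, π) : y + π(C) = C}`. -/
def AutSet (C : Set (F ι)) : Set (F ι × Equiv.Perm ι) :=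
  {p | translateCode p.1 (permCode p.2 C) = C}

/-- A (reduced) code is transitive if for every codeword `y` there is a permutation `π`
with `y + π(C) = C`. -/
def IsTransitive (C : Set (F ι)) : Prop :=
  ∀ y ∈ C, ∃ π : Equiv.Perm ι, translateCode y (permCode π C) = C

/-- A code is propelinear if `Aut(C)` contains a subgroup acting regularly on `C`
(the group law is `(y, π) * (y', π') = (y + π(y'), π ∘ π')`, acting by `(y,π) • x = y + π(x)`). -/
def IsPropelinear (C : Set (F ι)) : Prop :=
  ∃ A : Set (F ι × Equiv.Perm ι),
    (∀ a ∈ A, translateCode a.1 (permCode a.2 C) = C) ∧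
    ((0, 1) ∈ A) ∧
    (∀ a ∈ A, ∀ b ∈ A, (a.1 + permAct a.2 b.1, a.2 * b.2) ∈ A) ∧
    (∀ a ∈ A, (permAct a.2⁻¹ a.1, a.2⁻¹) ∈ A) ∧
    (∀ c ∈ C, ∀ c' ∈ C, ∃! a, a ∈ A ∧ a.1 + permAct a.2 c = c')

variable [Fintype ι] [DecidableEq ι]

/-- A perfect (1-error-correcting) code: every vector is within Hamming distance 1 of
exactly one codeword. -/
def IsPerfect (C : Set (F ι)) : Prop :=
  ∀ x : F ι, ∃! c, c ∈ C ∧ hammingDist x c ≤ 1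

/-- `STS(C, y) = {supp (x + y) : x ∈ C, d(x, y) = 3}`. -/
def STS (C : Set (F ι)) (y : F ι) : Set (Set ι) :=
  {s | ∃ x ∈ C, hammingDist x y = 3 ∧ s = supp (x + y)}

/-- A reduced perfect code is homogeneous if each `STS(C,y)`, `y ∈ C`, is isomorphic
to `STS(C, 0)`. -/
def IsHomogeneous (C : Set (F ι)) : Prop :=
  ∀ y ∈ C, ∃ π : Equiv.Perm ι, (Set.image π) '' (STS C y) = STS C (0 : F ι)

/-- The (mod 2) weight `|x| = x_1 + ⋯ + x_n`. -/
def wt (x : F ι) : ZMod 2 := ∑ i, x i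

/-- The scalar product `u · y = Σ u_i y_i (mod 2)`. -/
def dot (u y : F ι) : ZMod 2 := ∑ i, u i * y i

/-- A linear code: a subspace of `F ι` (over `ZMod 2` it suffices to be closed under `+`). -/
def IsLinearCode (C : Set (F ι)) : Prop :=
  (0 : F ι) ∈ C ∧ ∀ x ∈ C, ∀ y ∈ C, x + y ∈ C

/-- A Hamming code: a linear perfect code. -/
def IsHammingCode (C : Set (F ι)) : Prop := IsLinearCode C ∧ IsPerfect C

/-- The `i`-component `R_i`: the linear span of the weight-3 codewords of `H` whose
support contains `i`. -/
def component (H : Set (F ι)) (i : ι) : Set (F ι) :=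
  ↑(Submodule.span (ZMod 2) {x | x ∈ H ∧ hammingNorm x = 3 ∧ x i ≠ 0})

/-- `lam` pierces `R` if it takes both values 0 and 1 on `R`. -/
def Pierces (lam : F ι → ZMod 2) (R : Set (F ι)) : Prop :=
  (∃ x ∈ R, lam x = 0) ∧ (∃ x ∈ R, lam x = 1)

/-- The vector `(a, b, c)` of length `2n+1`: coordinates `1..n` are `a`, coordinate `n+1`
is `b`, coordinates `n+2..2n+1` are `c`. -/
def vasVec (a : F ι) (b : ZMod 2) (c : F ι) : F (ι ⊕ Unit ⊕ ι) :=
  Sum.elim a (Sum.elim (fun _ => b) c)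

/-- The Vasil'ev code `V_C^λ = {(x + y, |x| + λ(y), x) : x ∈ F^n, y ∈ C}`. -/
def Vasiliev (C : Set (F ι)) (lam : F ι → ZMod 2) : Set (F (ι ⊕ Unit ⊕ ι)) :=
  {v | ∃ x : F ι, ∃ y ∈ C, v = vasVec (x + y) (wt x + lam y) x}

/-- The subspace `R_{n+1}^{2n+1} = {(x, |x|, x) : x ∈ F^n}`. -/
def Rmid : Set (F (ι ⊕ Unit ⊕ ι)) := {v | ∃ x : F ι, v = vasVec x (wt x) x}

/-- Underlying function of `τ_u`: swaps positions `i` and `i + n + 1` for `i ∈ supp u`. -/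
def tauFun (u : F ι) : (ι ⊕ Unit ⊕ ι) → (ι ⊕ Unit ⊕ ι)
  | Sum.inl i => if u i ≠ 0 then Sum.inr (Sum.inr i) else Sum.inl i
  | Sum.inr (Sum.inl _) => Sum.inr (Sum.inl ())
  | Sum.inr (Sum.inr i) => if u i ≠ 0 then Sum.inl i else Sum.inr (Sum.inr i)

theorem tauFun_involutive (u : F ι) : Function.Involutive (tauFun u) := by
  intro x
  rcases x with i | x
  · by_cases h : u i = 0 <;> simp [tauFun, h]
  · rcases x with u' | i
    · simp [tauFun]
    · by_cases h : u i = 0 <;> simp [tauFun, h]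

/-- The permutation `τ_u`: the product of transpositions `(i, i+n+1)` over `i ∈ supp u`. -/
def tau (u : F ι) : Equiv.Perm (ι ⊕ Unit ⊕ ι) :=
  Function.Involutive.toPerm (tauFun u) (tauFun_involutive u)

/-- The duplicator `σ_π`: fixes position `n+1`, sends `i ↦ π(i)` and `i+n+1 ↦ π(i)+n+1`. -/
def dup (π : Equiv.Perm ι) : Equiv.Perm (ι ⊕ Unit ⊕ ι) :=
  Equiv.sumCongr π (Equiv.sumCongr (Equiv.refl Unit) π)

/-- The extension of `λ` one step up the Vasil'ev recursion: `λ'(z) = λ(y)` for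
`z ∈ (y, 0^{m+1}) + R_{m+1}^{2m+1}` (well defined by recovering `y` from `z`). -/
def lamSucc (lam : F ι → ZMod 2) : F (ι ⊕ Unit ⊕ ι) → ZMod 2 :=
  fun z => lam (fun i => z (Sum.inl i) + z (Sum.inr (Sum.inr i)))

/-- `T = {y' ∈ H : (y', λ(y'), 0) ∈ Tr(V_H^λ)}`. -/
def Tset (H : Set (F ι)) (lam : F ι → ZMod 2) : Set (F ι) :=
  {y' | y' ∈ H ∧ vasVec y' (lam y') 0 ∈ TrSet (Vasiliev H lam)}

/-- The Assmus–Mattson Steiner triple system `S^θ` of order `2n+1`. -/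
def AM (S : Set (Set ι)) (θ : Set ι → ZMod 2) : Set (Set (ι ⊕ Unit ⊕ ι)) :=
  {T | (∃ i : ι, T = {Sum.inl i, Sum.inr (Sum.inl ()), Sum.inr (Sum.inr i)}) ∨
    (∃ s ∈ S, θ s = 0 ∧
      (T = Sum.inl '' s ∨
        ∃ a ∈ s, T = insert (Sum.inl a) ((fun i => Sum.inr (Sum.inr i)) '' (s \ {a})))) ∨
    (∃ s ∈ S, θ s = 1 ∧
      (T = (fun i => Sum.inr (Sum.inr i)) '' s ∨
        ∃ a ∈ s, T = insert (Sum.inr (Sum.inr a)) (Sum.inl '' (s \ {a}))))}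

end Defs

/-- A Steiner triple system on the point set `α`. -/
def IsSTS {α : Type*} (S : Set (Set α)) : Prop :=
  (∀ s ∈ S, s.ncard = 3) ∧ ∀ i j : α, i ≠ j → ∃! s, s ∈ S ∧ i ∈ s ∧ j ∈ s

/-- The Mollard code (with zero function) of the codes `C` and `D`. -/
def Mollard {t r : Type*} [Fintype t] [Fintype r] (C : Set (F t)) (D : Set (F r)) :
    Set (F ((t × r) ⊕ t ⊕ r)) :=
  {v | ∃ x : F (t × r), ∃ c ∈ C, ∃ d ∈ D,
    v = Sum.elim x (Sum.elim (fun i => c i + ∑ j, x (i, j)) (fun j => d j + ∑ i, x (i, j)))}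

/-- Index types of the iterated Vasil'ev construction: lengths `n`, `2n+1`, `4n+3`, …. -/
def HType (n : ℕ) : ℕ → Type
  | 0 => Fin n
  | s + 1 => HType n s ⊕ Unit ⊕ HType n s

def HType.ft (n : ℕ) : ∀ s, Fintype (HType n s)
  | 0 => inferInstanceAs (Fintype (Fin n))
  | s + 1 =>
      letI := HType.ft n s
      inferInstanceAs (Fintype (HType n s ⊕ Unit ⊕ HType n s))

instance (n s : ℕ) : Fintype (HType n s) := HType.ft n s

def HType.deq (n : ℕ) : ∀ s, DecidableEq (HType n s)
  | 0 => inferInstanceAs (DecidableEq (Fin n))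
  | s + 1 =>
      letI := HType.deq n s
      inferInstanceAs (DecidableEq (HType n s ⊕ Unit ⊕ HType n s))

instance (n s : ℕ) : DecidableEq (HType n s) := HType.deq n s

/-- The iterated Hamming codes `H^n, H^{2n+1} = V_{H^n}^0, H^{4n+3}, …`. -/
def Hcode (n : ℕ) (H : Set (F (Fin n))) : ∀ s, Set (F (HType n s))
  | 0 => H
  | s + 1 => Vasiliev (Hcode n H s) 0

/-- The iterated functions `λ_n = λ`, `λ_{2m+1}` extending `λ_m`. -/
def lamIter (n : ℕ) (lam : F (Fin n) → ZMod 2) : ∀ s, F (HType n s) → ZMod 2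
  | 0 => lam
  | s + 1 => lamSucc (lamIter n lam s)

/-- `C_0 = V_{H^n}^λ`, `C_{s+1} = V_{C_s}^0`. -/
def Ccode (n : ℕ) (H : Set (F (Fin n))) (lam : F (Fin n) → ZMod 2) :
    ∀ s, Set (F (HType n (s + 1)))
  | 0 => Vasiliev H lam
  | s + 1 => Vasiliev (Ccode n H lam s) 0

/-- The binary digits of a natural number, as a vector over `ZMod 2`. -/
def bitVec (m : ℕ) : F (Fin 9) := fun k => if m.testBit k then 1 else 0

/-- The columns of a parity-check matrix of the kernel of the code, packed in base `2 ^ 12`;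
column `0` vanishes, columns `1, …, 15` belong to the coordinates. -/
def colNat (i : ℕ) : ℕ := (392366754794039867059608503453571504243729100429956706304 >>> (12 * i)) % 4096

/-- The syndromes of the codewords, as a bit mask. -/
def synMask : ℕ :=
  6494017421794843549178353452550047299130895115575234963193804813074630703673856860021575902034593606775966525606447946962236399127203769274089867265

/-- The `i`-th base-16 digit. -/
def hexDigit (m i : ℕ) : ℕ := (m >>> (4 * i)) % 16

/-- The coordinates whose columns are the unit vectors. -/
def unitCol (m : ℕ) : ℕ := hexDigit 68414056548 m

/-- The linear map sending the `m`-th unit vector to the column `P (unitCol m)`. -/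
def moveNat (P w : ℕ) : ℕ :=
  (List.finRange 9).foldl
    (fun a (m : Fin 9) => a ^^^ (if w.testBit m then colNat (hexDigit P (unitCol m)) else 0)) 0

/-- For every syndrome `s` of a codeword, a permutation moving the zero word to a codeword with
syndrome `s`, packed in base 16. -/
def movers : List (ℕ × ℕ) :=
  [(0, 18364758544493064720), (11, 18296607694011205200), (22, 18297203491874567760),
   (53, 18364162742603231760), (56, 18296940639860262480), (77, 18296344842012690000),
   (99, 18296607693995538000), (126, 18297203491858777680), (142, 18297203487847974480),
   (173, 18364162742587441680), (179, 18363897833031217680), (200, 18296940635849459280),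
   (213, 18296344837986219600), (219, 18363897829004624400), (230, 18297203487832307280),
   (240, 18364758540450804240), (261, 18364162746614034960), (302, 18364493630894457360),
   (315, 18296607689968944720), (326, 18364493626867986960), (339, 18296607689984734800),
   (344, 18364758544477274640), (352, 18296940635833792080), (381, 18296344837970429520),
   (387, 18363897829020414480), (400, 18296940639876052560), (413, 18364162746629702160),
   (424, 18364758540466471440), (438, 18364493630910247440), (478, 18364493626883654160),
   (485, 18296344841997022800), (491, 18363897833046884880)]

/-- The Steiner triple system at the codeword with syndrome `56`, as a table: the third point
of the block through `a` and `b`, packed in base 16. -/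
def thirdPoint (a b : ℕ) : ℕ :=
  hexDigit
    8289293765672889783442764440989832854484412900134869294989320603035378269620064178628976370264849340146583802556419762085186679305455446209197034472463857355278590439742328878386416291520987256802057754137169110014321946050179100328385558052505568547492533205363276355016536598902020487652126956021125231120
    (16 * a + b)

/-- The exhaustive check behind `isomorphism_rigid`: an isomorphism of Steiner triple systems is
determined by the images `x, y, w` of the points `1, 3, 7`. -/
def rigidCheck (x y w : ℕ) : Bool :=
  let p11 := thirdPoint x y
  !(Nat.ble 9 p11) ||
  let p13 := thirdPoint x w
  !(Nat.ble 9 p13) ||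
  let p15 := thirdPoint y w
  !(Nat.ble 9 p15) ||
  let p9 := thirdPoint p11 p13
  !(Nat.ble 9 p9) ||
  let p14 := thirdPoint p11 p15
  !(Nat.ble 9 p14) ||
  let p12 := thirdPoint p13 p15
  !(Nat.ble 9 p12) ||
  let p5 := thirdPoint w p11
  !(Nat.beq p12 (thirdPoint x p5)) ||
  let p10 := thirdPoint y p5
  !(Nat.ble 9 p10) || !(Nat.beq p15 (thirdPoint p9 p10)) ||
  let p6 := thirdPoint x p15
  let p8 := thirdPoint y p12
  Nat.beq p10 10 && Nat.beq p11 12 && Nat.beq p12 11 &&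
    (Nat.beq x 5 && !(Nat.beq p5 1) || Nat.beq x 6 && !(Nat.beq p6 1) ||
      Nat.beq x 7 && !(Nat.beq w 1) || Nat.beq x 8 && !(Nat.beq p8 1))

theorem rigidCheck_eq_true : ∀ x < 16, ∀ y < 16, ∀ w < 16, rigidCheck x y w = true := by
  decide +kernel

theorem colNat_lt : ∀ i < 16, colNat i < 512 := by decide +kernel

theorem existsUnique_col : ∀ n < 512, ∃ i < 16, synMask.testBit (n ^^^ colNat i) = true ∧
    ∀ j < 16, synMask.testBit (n ^^^ colNat j) = true → j = i := by
  decide +kernel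

set_option synthInstance.maxHeartbeats 200000 in
set_option synthInstance.maxSize 1000 in
theorem colNat_xor_ne : ∀ a < 16, ∀ i < 16, ∀ b < 16, a ≠ 0 → i ≠ 0 → a ≠ i →
    colNat a ^^^ colNat i ≠ colNat b := by
  decide +kernel

theorem exists_mem_movers : ∀ s < 512, synMask.testBit s = true → ∃ e ∈ movers, e.1 = s := by
  decide +kernel

theorem fst_of_mem_movers : ∀ e ∈ movers, e.1 < 512 ∧ synMask.testBit e.1 = true := by
  decide +kernel

theorem synMask_period : ∀ w < 512,
    (∀ e ∈ movers, synMask.testBit (w ^^^ e.1) = true) → w = 0 := by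
  decide +kernel

theorem thirdPoint_eq : ∀ a < 16, ∀ b < 16, ∀ k < 16,
    synMask.testBit (56 ^^^ colNat a ^^^ colNat b ^^^ colNat k) = true → k = thirdPoint a b := by
  decide +kernel

set_option synthInstance.maxHeartbeats 200000 in
set_option synthInstance.maxSize 1000 in
theorem movers_spec : ∀ e ∈ movers, hexDigit e.2 0 = 0 ∧
    (∀ i < 16, ∀ j < 16, hexDigit e.2 i = hexDigit e.2 j → i = j) ∧
    (∀ i < 16, moveNat e.2 (colNat i) = colNat (hexDigit e.2 i)) ∧
    ∀ f ∈ movers, synMask.testBit (e.1 ^^^ moveNat e.2 f.1) = true := by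
  decide +kernel

theorem bitVec_xor (a b : ℕ) : bitVec (a ^^^ b) = bitVec a + bitVec b := by
  funext k
  simp only [bitVec, Nat.testBit_xor, Pi.add_apply]
  cases a.testBit k <;> cases b.testBit k <;> decide

theorem bitVec_injOn {a b : ℕ} (ha : a < 512) (hb : b < 512) (h : bitVec a = bitVec b) :
    a = b := by
  refine Nat.eq_of_testBit_eq fun i => ?_
  by_cases hi : i < 9
  · have := congrFun h ⟨i, hi⟩
    simp only [bitVec] at this
    cases h1 : a.testBit i <;> cases h2 : b.testBit i <;> simp_all
  · have hp : 512 ≤ 2 ^ i := by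
      calc 512 = 2 ^ 9 := by norm_num
        _ ≤ 2 ^ i := Nat.pow_le_pow_right (by norm_num) (by omega)
    rw [Nat.testBit_lt_two_pow (ha.trans_le hp), Nat.testBit_lt_two_pow (hb.trans_le hp)]

theorem exists_bitVec_eq (w : F (Fin 9)) : ∃ m < 512, bitVec m = w := by
  have hb : Function.Bijective fun m : Fin 512 => bitVec m :=
    (Fintype.bijective_iff_injective_and_card _).2
      ⟨fun a b h => Fin.ext (bitVec_injOn a.2 b.2 h), by simp⟩
  obtain ⟨m, hm⟩ := hb.2 w
  exact ⟨m, m.2, hm⟩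

/-- The columns of a parity-check matrix of the kernel of the code. -/
def col (i : Fin 16) : F (Fin 9) := bitVec (colNat i)

/-- The syndromes of the codewords. -/
def synSet : Set (F (Fin 9)) := {w | ∃ m < 512, synMask.testBit m = true ∧ bitVec m = w}

theorem bitVec_mem_synSet {m : ℕ} (hm : m < 512) :
    bitVec m ∈ synSet ↔ synMask.testBit m = true := by
  constructor
  · rintro ⟨k, hk, hs, h⟩
    rwa [← bitVec_injOn hk hm h]
  · exact fun h => ⟨m, hm, h, rfl⟩

theorem xor_lt_512 {a b : ℕ} (ha : a < 512) (hb : b < 512) : a ^^^ b < 512 :=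
  Nat.xor_lt_two_pow (n := 9) ha hb

theorem bitVec_foldl {α : Type*} (f : α → ℕ) (l : List α) (a : ℕ) :
    bitVec (l.foldl (fun a m => a ^^^ f m) a) =
      bitVec a + (l.map fun m => bitVec (f m)).sum := by
  induction l generalizing a with
  | nil => simp
  | cons m l ih => simp [ih, bitVec_xor, add_assoc]

theorem foldl_lt_512 {α : Type*} (f : α → ℕ) (hf : ∀ m, f m < 512) (l : List α) (a : ℕ)
    (ha : a < 512) : l.foldl (fun a m => a ^^^ f m) a < 512 := by
  induction l generalizing a with
  | nil => exact ha
  | cons m l ih => exact ih _ (xor_lt_512 ha (hf m))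

theorem zero_mem_synSet : (0 : F (Fin 9)) ∈ synSet :=
  ⟨0, by decide, by decide +kernel, by decide⟩

theorem col_zero : col 0 = 0 := by decide +kernel

theorem col_injective : Function.Injective col := by decide +kernel

theorem existsUnique_add_col_mem (w : F (Fin 9)) : ∃! i, w + col i ∈ synSet := by
  obtain ⟨m, hm, rfl⟩ := exists_bitVec_eq w
  have key (j : Fin 16) :
      bitVec m + col j ∈ synSet ↔ synMask.testBit (m ^^^ colNat j) = true := by
    rw [col, ← bitVec_xor, bitVec_mem_synSet (xor_lt_512 hm (colNat_lt j j.2))]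
  obtain ⟨i, hi, h1, h2⟩ := existsUnique_col m hm
  exact ⟨⟨i, hi⟩, (key _).2 h1, fun j hj => Fin.ext (h2 j j.2 ((key j).1 hj))⟩

theorem col_add_col_ne {a i : Fin 16} (b : Fin 16) (ha : a ≠ 0) (hi : i ≠ 0) (hai : a ≠ i) :
    col a + col i ≠ col b := by
  rw [col, col, ← bitVec_xor]
  intro h
  exact colNat_xor_ne a a.2 i i.2 b b.2 (fun h => ha (Fin.ext h)) (fun h => hi (Fin.ext h))
    (fun h => hai (Fin.ext h))
    (bitVec_injOn (xor_lt_512 (colNat_lt a a.2) (colNat_lt i i.2)) (colNat_lt b b.2) h)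

theorem synSet_period {w : F (Fin 9)} (h : ∀ s ∈ synSet, w + s ∈ synSet) : w = 0 := by
  obtain ⟨m, hm, rfl⟩ := exists_bitVec_eq w
  rw [synMask_period m hm fun e he => ?_]
  · decide
  · obtain ⟨hlt, hbit⟩ := fst_of_mem_movers e he
    rw [← bitVec_mem_synSet (xor_lt_512 hm hlt), bitVec_xor]
    exact h _ ((bitVec_mem_synSet hlt).2 hbit)

/-- A linear functional vanishing on all syndromes of codewords. -/
def check : F (Fin 9) →ₗ[ZMod 2] ZMod 2 :=
  (LinearMap.proj 0 : F (Fin 9) →ₗ[ZMod 2] ZMod 2) + LinearMap.proj 1 + LinearMap.proj 2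

theorem check_eq_zero {w : F (Fin 9)} (hw : w ∈ synSet) : check w = 0 := by
  obtain ⟨m, hm, hbit, rfl⟩ := hw
  have : ∀ m < 512, synMask.testBit m = true → check (bitVec m) = 0 := by decide +kernel
  exact this m hm hbit

theorem eq_zero_or_nine_le : ∀ i : Fin 16, check (col i) = 0 → i = 0 ∨ 9 ≤ i := by
  decide +kernel

theorem exists_col_eq_sum {z : Fin 16} (hz : 9 ≤ z) :
    ∃ a ∈ synSet, ∃ b ∈ synSet, ∃ c ∈ synSet, col z = a + b + c := by
  have key : ∀ z : Fin 16, 9 ≤ z → ∃ t ∈ [(11, 22, 485), (22, 173, 179), (53, 213, 240),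
      (11, 219, 240), (11, 53, 126), (11, 56, 179), (11, 77, 326)],
      synMask.testBit t.1 = true ∧ synMask.testBit t.2.1 = true ∧
      synMask.testBit t.2.2 = true ∧ t.1 < 512 ∧ t.2.1 < 512 ∧ t.2.2 < 512 ∧
      colNat z = t.1 ^^^ t.2.1 ^^^ t.2.2 := by decide +kernel
  obtain ⟨⟨a, b, c⟩, -, h1, h2, h3, h4, h5, h6, h⟩ := key z hz
  refine ⟨_, ⟨a, h4, h1, rfl⟩, _, ⟨b, h5, h2, rfl⟩, _, ⟨c, h6, h3, rfl⟩, ?_⟩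
  rw [col, h, bitVec_xor, bitVec_xor]

/-- The coordinate of the `m`-th unit vector. -/
def unitIdx (m : Fin 9) : Fin 16 := ⟨unitCol m, Nat.mod_lt _ (by norm_num)⟩

theorem col_unitIdx : ∀ m : Fin 9, col (unitIdx m) = Pi.single m 1 := by
  decide +kernel

theorem exists_mover {s : F (Fin 9)} (hs : s ∈ synSet) :
    ∃ (p : Equiv.Perm (Fin 16)) (g : F (Fin 9) →ₗ[ZMod 2] F (Fin 9)), p 0 = 0 ∧
      (∀ i, g (col i) = col (p i)) ∧ ∀ t ∈ synSet, s + g t ∈ synSet := by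
  obtain ⟨m, hm, hbit, rfl⟩ := hs
  obtain ⟨⟨m', P⟩, he, rfl⟩ := exists_mem_movers m hm hbit
  obtain ⟨h0, hinj, hcol, hmem⟩ := movers_spec _ he
  let f (i : Fin 16) : Fin 16 := ⟨hexDigit P i, Nat.mod_lt _ (by norm_num)⟩
  have hf : Function.Injective f := fun i j h =>
    Fin.ext (hinj i i.2 j j.2 (congrArg Fin.val h))
  let g : F (Fin 9) →ₗ[ZMod 2] F (Fin 9) :=
    Fintype.linearCombination (ZMod 2) fun k => col (f (unitIdx k))
  have hg (w : ℕ) : g (bitVec w) = bitVec (moveNat P w) := by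
    have hz : bitVec 0 = 0 := by decide
    have hite (k : Fin 9) (c : ℕ) :
        bitVec (if w.testBit k then c else 0) = bitVec w k • bitVec c := by
      simp only [bitVec]
      cases w.testBit k
      · simpa using hz
      · simp
    rw [moveNat, bitVec_foldl, hz, zero_add, Fintype.linearCombination_apply, Fin.sum_univ_def]
    simp only [hite]
    rfl
  refine ⟨Equiv.ofBijective f (Finite.injective_iff_bijective.1 hf), g, Fin.ext h0, fun i => ?_,
    ?_⟩
  · rw [col, hg, hcol i i.2]
    rfl
  · rintro _ ⟨t, ht, htb, rfl⟩
    rw [hg, ← bitVec_xor]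
    have hlt : moveNat P t < 512 := foldl_lt_512 _ (fun k => by
      split_ifs
      · exact colNat_lt _ (Nat.mod_lt _ (by norm_num))
      · norm_num) _ _ (by norm_num)
    obtain ⟨f, hf, rfl⟩ := exists_mem_movers t ht htb
    exact (bitVec_mem_synSet (xor_lt_512 hm hlt)).2 (hmem f hf)

theorem col_add_col_add_col : col 10 + col 11 + col 12 = bitVec 56 := by decide +kernel

/-- A map of the coordinates that takes the blocks of the Steiner triple system at the zero word
to those at the codeword with support `{10, 11, 12}` is very restricted. -/
theorem isomorphism_rigid {p : Fin 16 → Fin 16}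
    (hp : ∀ i j k, col i + col j + col k ∈ synSet →
      col 10 + col 11 + col 12 + (col (p i) + col (p j) + col (p k)) ∈ synSet)
    (hz : ∀ z, 9 ≤ z → 9 ≤ p z) : p 10 = 10 ∧ p 11 = 12 ∧ p 12 = 11 ∧ p (p 1) ≠ 1 := by
  have h3 : ∀ i j k : Fin 16,
      synMask.testBit (colNat i ^^^ colNat j ^^^ colNat k) = true →
      (p k : ℕ) = thirdPoint (p i) (p j) := by
    intro i j k h
    have lt (i : Fin 16) := colNat_lt i i.2
    have h1 := hp i j k <| by
      rw [col, col, col, ← bitVec_xor, ← bitVec_xor,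
        bitVec_mem_synSet (xor_lt_512 (xor_lt_512 (lt i) (lt j)) (lt k))]
      exact h
    rw [col_add_col_add_col, ← add_assoc, ← add_assoc, col, col, col, ← bitVec_xor,
      ← bitVec_xor, ← bitVec_xor, bitVec_mem_synSet
        (xor_lt_512 (xor_lt_512 (xor_lt_512 (by norm_num) (lt _)) (lt _)) (lt _))] at h1
    exact thirdPoint_eq _ (p i).2 _ (p j).2 _ (p k).2 h1
  have h11 := h3 1 3 11 (by decide +kernel)
  have h13 := h3 1 7 13 (by decide +kernel)
  have h15 := h3 3 7 15 (by decide +kernel)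
  have h6 := h3 1 15 6 (by decide +kernel)
  have h5 := h3 7 11 5 (by decide +kernel)
  have h9 := h3 11 13 9 (by decide +kernel)
  have h14 := h3 11 15 14 (by decide +kernel)
  have h12 := h3 13 15 12 (by decide +kernel)
  have h10 := h3 3 5 10 (by decide +kernel)
  have h8 := h3 3 12 8 (by decide +kernel)
  have h12' := h3 1 5 12 (by decide +kernel)
  have h15' := h3 9 10 15 (by decide +kernel)
  have hc := rigidCheck_eq_true _ (p 1).2 _ (p 3).2 _ (p 7).2
  have ble (z : Fin 16) (h : 9 ≤ z) : Nat.ble 9 (p z) = true := Nat.ble_eq_true_of_le (hz z h)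
  simp only [rigidCheck, ← h11, ← h13, ← h15, ← h6, ← h5, ← h9, ← h14, ← h12, ← h10, ← h8, ← h12',
    ← h15', ble 9 (by decide), ble 10 (by decide), ble 11 (by decide), ble 12 (by decide),
    ble 13 (by decide), ble 14 (by decide), ble 15 (by decide)] at hc
  simp only [Nat.beq_refl, Bool.not_true, Bool.false_or, Bool.and_eq_true, Bool.or_eq_true,
    Nat.beq_eq, Bool.not_eq_true'] at hc
  obtain ⟨⟨⟨e10, e11⟩, e12⟩, e⟩ := hc
  refine ⟨Fin.ext e10, Fin.ext e11, Fin.ext e12, ?_⟩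
  have aux (q : Fin 16) (h : (p 1 : ℕ) = q) (hne : Nat.beq (p q) 1 = false) : p (p 1) ≠ 1 := by
    rw [Fin.ext h]
    intro h'
    simp [h'] at hne
  rcases e with ((⟨h, h'⟩ | ⟨h, h'⟩) | ⟨h, h'⟩) | ⟨h, h'⟩
  · exact aux 5 h h'
  · exact aux 6 h h'
  · exact aux 7 h h'
  · exact aux 8 h h'

/-- A linear injection that permutes the columns `(col i, r)` and, up to the translation by the
syndrome `col 10 + col 11 + col 12`, the syndromes of the codewords is very restricted. -/
theorem linear_rigid {R : Type*} [AddCommGroup R] [Module (ZMod 2) R]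
    (g : F (Fin 9) × R →ₗ[ZMod 2] F (Fin 9) × R) (hg : Function.Injective g)
    (hcol : ∀ i r, ∃ i', (g (col i, r)).1 = col i')
    (hS : ∀ s ∈ synSet, col 10 + col 11 + col 12 + (g (s, 0)).1 ∈ synSet ∧ (g (s, 0)).2 = 0) :
    g (col 10, 0) = (col 10, 0) ∧ g (col 11, 0) = (col 12, 0) ∧ g (col 12, 0) = (col 11, 0) ∧
      g (g (col 1, 0)) ≠ (col 1, 0) := by
  choose p hp using fun i => hcol i 0
  have hadd (v w : F (Fin 9)) : g (v + w, 0) = g (v, 0) + g (w, 0) := by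
    rw [← map_add, Prod.mk_add_mk, add_zero]
  have hsnd (z : Fin 16) (hz : 9 ≤ z) : g (col z, 0) = (col (p z), 0) := by
    refine Prod.ext (hp z) ?_
    obtain ⟨a, ha, b, hb, c, hc, h⟩ := exists_col_eq_sum hz
    simp [h, hadd, (hS a ha).2, (hS b hb).2, (hS c hc).2]
  have hcheck (s : F (Fin 9)) (hs : s ∈ synSet) : check (g (s, 0)).1 = 0 := by
    have h1 := check_eq_zero (hS s hs).1
    have h2 : check (col 10 + col 11 + col 12) = 0 := by decide +kernel
    rwa [map_add, h2, zero_add] at h1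
  have hpz (z : Fin 16) (hz : 9 ≤ z) : 9 ≤ p z := by
    refine (eq_zero_or_nine_le (p z) ?_).resolve_left fun h => ?_
    · obtain ⟨a, ha, b, hb, c, hc, h⟩ := exists_col_eq_sum hz
      rw [← hp, h, hadd, hadd, Prod.fst_add, Prod.fst_add, map_add, map_add, hcheck a ha,
        hcheck b hb, hcheck c hc]
      rfl
    · have h1 := hsnd z hz
      rw [h, col_zero, Prod.mk_zero_zero, map_eq_zero_iff g hg, Prod.mk_eq_zero,
        ← col_zero] at h1
      have := col_injective h1.1
      subst this
      exact absurd hz (by decide)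
  have hfst (r : R) : (g (0, r)).1 = 0 := by
    obtain ⟨a, ha⟩ := hcol 0 r
    rw [col_zero] at ha
    by_contra hne
    have ha0 : a ≠ 0 := by
      rintro rfl
      exact hne (ha.trans col_zero)
    have heq (z : Fin 16) (hz : 9 ≤ z) : a = p z := by
      by_contra haz
      obtain ⟨b, hb⟩ := hcol z r
      have hsplit : ((col z, r) : F (Fin 9) × R) = (0, r) + (col z, 0) := by simp
      rw [hsplit, map_add, Prod.fst_add, ha, hp] at hb
      refine col_add_col_ne b ha0 (fun h => ?_) haz hb
      have := hpz z hz
      rw [h] at this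
      exact absurd this (by decide)
    have h1 := hsnd 9 (by decide)
    rw [← heq 9 (by decide), heq 10 (by decide), ← hsnd 10 (by decide)] at h1
    have h2 := col_injective (congrArg Prod.fst (hg h1))
    exact absurd h2 (by decide)
  obtain ⟨h10, h11, h12, h1⟩ := isomorphism_rigid (p := p) (fun i j k h => by
    have h' := (hS _ h).1
    rwa [hadd, hadd, Prod.fst_add, Prod.fst_add, hp, hp, hp] at h') hpz
  refine ⟨by rw [hsnd 10 (by decide), h10], by rw [hsnd 11 (by decide), h11],
    by rw [hsnd 12 (by decide), h12], fun h => h1 (col_injective ?_)⟩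
  have hsplit : g (col 1, 0) = (col (p 1), 0) + (0, (g (col 1, 0)).2) := by
    refine Prod.ext ?_ ?_
    · simp [hp]
    · simp
  rw [hsplit, map_add] at h
  have h' := congrArg Prod.fst h
  rwa [Prod.fst_add, hp, hfst, add_zero] at h'

section SyndromeCode

variable {ι W : Type*} [Fintype ι] [DecidableEq ι] [AddCommGroup W] [Module (ZMod 2) W]

/-- The vector with support `{o}`, or zero if `o = none`. -/
def unitVec : Option ι → F ι
  | none => 0
  | some i => Pi.single i 1

/-- The syndrome of a vector with respect to the columns `h`. -/
def syndrome (h : Option ι → W) : F ι →ₗ[ZMod 2] W :=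
  Fintype.linearCombination (ZMod 2) fun i => h (some i)

theorem syndrome_unitVec {h : Option ι → W} (h0 : h none = 0) (o : Option ι) :
    syndrome h (unitVec o) = h o := by
  cases o with
  | none => rw [unitVec, map_zero, h0]
  | some i => rw [unitVec, syndrome, Fintype.linearCombination_apply_single, one_smul]

theorem permAct_unitVec (π : Equiv.Perm ι) (o : Option ι) :
    permAct π (unitVec o) = unitVec (o.map π) := by
  cases o with
  | none => rfl
  | some i =>
    funext j
    simp [permAct, unitVec, Pi.single_apply, Equiv.symm_apply_eq]

theorem permAct_add (π : Equiv.Perm ι) (x y : F ι) :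
    permAct π (x + y) = permAct π x + permAct π y := rfl

theorem permAct_symm_permAct (π : Equiv.Perm ι) (x : F ι) :
    permAct π (permAct π.symm x) = x := by
  funext j
  simp [permAct]

theorem F_add_self (x : F ι) : x + x = 0 := funext fun i => CharTwo.add_self_eq_zero (x i)

theorem hammingDist_le_one_iff (x c : F ι) : hammingDist x c ≤ 1 ↔ ∃ o, c = x + unitVec o := by
  constructor
  · intro h
    rw [hammingDist, Finset.card_le_one] at h
    by_cases hxc : x = c
    · exact ⟨none, by rw [unitVec, add_zero, hxc]⟩
    obtain ⟨i, hi⟩ := Function.ne_iff.1 hxc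
    refine ⟨some i, funext fun j => ?_⟩
    have key : ∀ a b : ZMod 2, a ≠ b → b = a + 1 := by decide
    rcases eq_or_ne j i with rfl | hj
    · simpa [unitVec] using key _ _ hi
    · by_contra hne
      refine hj (h j (by simpa [unitVec, hj, eq_comm] using hne) i (by simpa using hi))
  · rintro ⟨o, rfl⟩
    rw [hammingDist, Finset.card_le_one_iff]
    cases o with
    | none => simp [unitVec]
    | some i =>
      intro a b ha hb
      simp only [unitVec, Pi.add_apply, Pi.single_apply, Finset.mem_filter, Finset.mem_univ,
        true_and, ne_eq, left_eq_add, ite_eq_right_iff, one_ne_zero, imp_false, not_not] at ha hb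
      rw [ha, hb]

/-- The code of all vectors whose syndrome lies in `S`. -/
def syndromeCode (h : Option ι → W) (S : Set W) : Set (F ι) := {x | syndrome h x ∈ S}

theorem mem_syndromeCode {h : Option ι → W} {S : Set W} {x : F ι} :
    x ∈ syndromeCode h S ↔ syndrome h x ∈ S := Iff.rfl

theorem isPerfect_syndromeCode {h : Option ι → W} (h0 : h none = 0) {S : Set W}
    (hS : ∀ w, ∃! o, w + h o ∈ S) : IsPerfect (syndromeCode h S) := by
  intro x
  obtain ⟨o, ho, huniq⟩ := hS (syndrome h x)
  refine ⟨x + unitVec o, ⟨?_, (hammingDist_le_one_iff _ _).2 ⟨o, rfl⟩⟩, ?_⟩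
  · rwa [mem_syndromeCode, map_add, syndrome_unitVec h0]
  · rintro c ⟨hc, hd⟩
    obtain ⟨o', rfl⟩ := (hammingDist_le_one_iff _ _).1 hd
    rw [mem_syndromeCode, map_add, syndrome_unitVec h0] at hc
    rw [huniq o' hc]

theorem translateCode_permCode_eq {C : Set (F ι)} {y : F ι} {π : Equiv.Perm ι}
    (h : ∀ x ∈ C, y + permAct π x ∈ C) : translateCode y (permCode π C) = C := by
  have hinj : Function.Injective fun x : F ι => y + permAct π x := fun a b hab => by
    funext j
    have := congrFun (add_left_cancel hab) (π j)
    simpa [permAct] using this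
  have himg : translateCode y (permCode π C) = (fun x => y + permAct π x) '' C := by
    rw [translateCode, permCode, Set.image_image]
  rw [himg]
  refine Set.eq_of_subset_of_ncard_le ?_ (Set.ncard_image_of_injective C hinj).ge
    (Set.toFinite _)
  rintro _ ⟨x, hx, rfl⟩
  exact h x hx

theorem mem_iff_of_translateCode_permCode_eq {C : Set (F ι)} {y : F ι} {π : Equiv.Perm ι}
    (h : translateCode y (permCode π C) = C) (x : F ι) : x ∈ C ↔ y + permAct π x ∈ C := by
  constructor
  · intro hx
    rw [← h]
    exact ⟨_, ⟨x, hx, rfl⟩, rfl⟩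
  · intro hx
    rw [← h] at hx
    obtain ⟨_, ⟨x', hx', rfl⟩, h'⟩ := hx
    have : x' = x := by
      funext j
      have := congrFun (add_left_cancel h') (π j)
      simpa [permAct] using this
    rwa [← this]

/-- The syndrome intertwines a coordinate permutation with a linear map that permutes the columns
in the same way. -/
theorem syndrome_permAct {h : Option ι → W} (π : Equiv.Perm ι) (g : W →ₗ[ZMod 2] W)
    (hg : ∀ i, g (h (some i)) = h (some (π i))) (x : F ι) :
    syndrome h (permAct π x) = g (syndrome h x) := by
  simp only [syndrome, Fintype.linearCombination_apply, map_sum, map_smul, hg]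
  exact Fintype.sum_equiv π.symm _ _ fun i => by simp [permAct]

/-- An automorphism of a syndrome code whose set of syndromes has no period induces a linear
map. -/
theorem exists_linearMap_of_translateCode_permCode_eq {h : Option ι → W} {S : Set W}
    (hsurj : Function.Surjective (syndrome h))
    (hper : ∀ w, (∀ s ∈ S, w + s ∈ S) → w = 0) {y : F ι} {π : Equiv.Perm ι}
    (hy : translateCode y (permCode π (syndromeCode h S)) = syndromeCode h S) :
    ∃ g : W →ₗ[ZMod 2] W, Function.Injective g ∧
      ∀ x, g (syndrome h x) = syndrome h (permAct π x) := by
  have hiff := mem_iff_of_translateCode_permCode_eq hy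
  have hker (k : F ι) (hk : syndrome h k = 0) : syndrome h (permAct π k) = 0 := by
    refine hper _ fun s hs => ?_
    obtain ⟨u, rfl⟩ := hsurj s
    have hu : y + permAct π (permAct π.symm (y + u)) = u := by
      rw [permAct_symm_permAct, ← add_assoc, F_add_self, zero_add]
    have h1 : permAct π.symm (y + u) + k ∈ syndromeCode h S := by
      have : permAct π.symm (y + u) ∈ syndromeCode h S := (hiff _).2 (by rw [hu]; exact hs)
      rwa [mem_syndromeCode, map_add, hk, add_zero]
    rw [hiff, permAct_add, ← add_assoc, hu] at h1
    rwa [mem_syndromeCode, map_add, add_comm] at h1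
  obtain ⟨r, hr⟩ := (syndrome h).exists_rightInverse_of_surjective (LinearMap.range_eq_top.2 hsurj)
  let P : F ι →ₗ[ZMod 2] F ι := LinearMap.funLeft (ZMod 2) (ZMod 2) π.symm
  let g : W →ₗ[ZMod 2] W := syndrome h ∘ₗ P ∘ₗ r
  have hgP (x : F ι) : g (syndrome h x) = syndrome h (permAct π x) := by
    have h1 : syndrome h (r (syndrome h x)) = syndrome h x := LinearMap.congr_fun hr _
    have h2 : syndrome h (P (r (syndrome h x) - x)) = 0 :=
      hker (r (syndrome h x) - x) (by rw [map_sub, h1, sub_self])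
    rwa [map_sub, map_sub, sub_eq_zero] at h2
  have : Finite W := Finite.of_surjective _ hsurj
  refine ⟨g, Finite.injective_iff_surjective.2 fun w => ?_, hgP⟩
  obtain ⟨x, rfl⟩ := hsurj w
  exact ⟨syndrome h (permAct π.symm x), by rw [hgP, permAct_symm_permAct]⟩

end SyndromeCode

section Extension

variable {ι R : Type*} [Fintype ι] [DecidableEq ι] [AddCommGroup R] [Module (ZMod 2) R]
  (e : Option ι ≃ Fin 16 × R)

/-- The columns `(col i, r)`, for all `i` and all `r : R`. -/
def extCol (o : Option ι) : F (Fin 9) × R := (col (e o).1, (e o).2)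

/-- The syndromes of the codewords, padded by zero. -/
def extSynSet (R : Type*) [AddCommGroup R] : Set (F (Fin 9) × R) := synSet ×ˢ {0}

theorem extCol_injective : Function.Injective (extCol e) := fun _ _ h =>
  e.injective (Prod.ext (col_injective (congrArg Prod.fst h)) (congrArg (fun w => w.2) h))

theorem extCol_symm (i : Fin 16) (r : R) : extCol e (e.symm (i, r)) = (col i, r) := by
  simp [extCol]

theorem extSynSet_period (w : F (Fin 9) × R) (h : ∀ s ∈ extSynSet R, w + s ∈ extSynSet R) :
    w = 0 := by
  refine Prod.ext (synSet_period fun s hs => (h (s, 0) ⟨hs, rfl⟩).1) ?_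
  simpa using (h (0, 0) ⟨zero_mem_synSet, rfl⟩).2

variable (he : e none = (0, 0))

include he

theorem extCol_none : extCol e none = 0 := by
  rw [extCol, he, col_zero]
  rfl

theorem existsUnique_add_extCol_mem (w : F (Fin 9) × R) :
    ∃! o, w + extCol e o ∈ extSynSet R := by
  obtain ⟨i, hi, huniq⟩ := existsUnique_add_col_mem w.1
  refine ⟨e.symm (i, -w.2), ?_, fun o ho => ?_⟩
  · change w + extCol e _ ∈ _
    rw [extCol_symm]
    exact ⟨hi, add_neg_cancel w.2⟩
  · rw [Equiv.eq_symm_apply]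
    exact Prod.ext (huniq _ ho.1) (eq_neg_of_add_eq_zero_right ho.2)

theorem syndrome_extCol_surjective : Function.Surjective (syndrome (extCol e)) := by
  rintro ⟨v, r⟩
  have hmem (i : Fin 16) (r : R) : (col i, r) ∈ LinearMap.range (syndrome (extCol e)) :=
    ⟨unitVec (e.symm (i, r)), by rw [syndrome_unitVec (extCol_none e he), extCol_symm]⟩
  have hsum : (v, r) = (col 0, r) + ∑ m, v m • (col (unitIdx m), (0 : R)) := by
    refine Prod.ext ?_ ?_
    · simp only [col_unitIdx, col_zero, Prod.fst_add, zero_add, Prod.fst_sum, Prod.smul_fst]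
      exact pi_eq_sum_univ' v
    · simp [Prod.snd_sum]
  rw [← LinearMap.mem_range, hsum]
  exact add_mem (hmem 0 r) (sum_mem fun m _ => Submodule.smul_mem _ _ (hmem _ 0))

theorem isTransitive_syndromeCode : IsTransitive (syndromeCode (extCol e) (extSynSet R)) := by
  intro y hy
  obtain ⟨p, g, hp0, hpg, hg⟩ := exists_mover hy.1
  let σ : Equiv.Perm (Option ι) :=
    (e.trans (p.prodCongr (Equiv.refl R))).trans e.symm
  have hσ : σ none = none := by simp [σ, he, hp0, Equiv.symm_apply_eq]
  have hsome (i : ι) : some (Equiv.removeNone σ i) = σ (some i) := by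
    refine Equiv.removeNone_some σ (Option.ne_none_iff_exists'.1 fun h => ?_)
    exact Option.some_ne_none i (σ.injective (h.trans hσ.symm))
  refine ⟨Equiv.removeNone σ, translateCode_permCode_eq fun x hx => ?_⟩
  rw [mem_syndromeCode, map_add, syndrome_permAct _ (g.prodMap LinearMap.id)]
  · exact ⟨hg _ hx.1, by
      have h1 : (syndrome (extCol e) y).2 = 0 := hy.2
      have h2 : (syndrome (extCol e) x).2 = 0 := hx.2
      simp [h1, h2]⟩
  · intro i
    simp [hsome, σ, extCol, hpg]

theorem not_isPropelinear_syndromeCode :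
    ¬ IsPropelinear (syndromeCode (extCol e) (extSynSet R)) := by
  rintro ⟨A, hA, hone, hmul, -, hreg⟩
  have hsyn (o : Option ι) : syndrome (extCol e) (unitVec o) = extCol e o :=
    syndrome_unitVec (extCol_none e he) o
  have h0 : (0 : F ι) ∈ syndromeCode (extCol e) (extSynSet R) := by
    rw [mem_syndromeCode, map_zero]
    exact ⟨zero_mem_synSet, rfl⟩
  let q (i : Fin 16) : Option ι := e.symm (i, 0)
  let c : F ι := unitVec (q 10) + unitVec (q 11) + unitVec (q 12)
  have hcsyn : syndrome (extCol e) c = (col 10 + col 11 + col 12, 0) := by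
    simp [c, q, hsyn, extCol_symm]
  have hc : c ∈ syndromeCode (extCol e) (extSynSet R) := by
    rw [mem_syndromeCode, hcsyn]
    exact ⟨⟨56, by norm_num, by decide +kernel, col_add_col_add_col.symm⟩, rfl⟩
  obtain ⟨⟨y, π⟩, ⟨hmem, hy⟩, -⟩ := hreg 0 h0 c hc
  obtain rfl : y = c := by rw [← hy]; exact (add_zero y).symm
  have hiff := mem_iff_of_translateCode_permCode_eq (hA _ hmem)
  have hsurj := syndrome_extCol_surjective e he
  obtain ⟨g, hinj, hg⟩ := exists_linearMap_of_translateCode_permCode_eq hsurj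
    extSynSet_period (hA _ hmem)
  have hgcol (o : Option ι) : g (extCol e o) = extCol e (o.map π) := by
    rw [← hsyn, hg, permAct_unitVec, hsyn]
  obtain ⟨h10, h11, h12, h1⟩ := linear_rigid g hinj
    (fun i r => by
      rw [← extCol_symm e, hgcol]
      exact ⟨_, rfl⟩)
    (fun s hs => by
      obtain ⟨x, hx⟩ := hsurj (s, 0)
      have hxC : x ∈ syndromeCode (extCol e) (extSynSet R) := by
        rw [mem_syndromeCode, hx]
        exact ⟨hs, rfl⟩
      have h := (hiff x).1 hxC
      rw [mem_syndromeCode, map_add, hcsyn, ← hg, hx] at h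
      exact ⟨h.1, by simpa using h.2⟩)
  have hq (i j : Fin 16) (h : g (col i, 0) = (col j, 0)) : (q i).map π = q j := by
    refine extCol_injective e ?_
    rw [← hgcol, extCol_symm, extCol_symm, h]
  have hπc : permAct π c = c := by
    simp only [c, permAct_add, permAct_unitVec, hq 10 10 h10, hq 11 12 h11, hq 12 11 h12]
    abel
  have hsq := hmul _ hmem _ hmem
  simp only [hπc, F_add_self] at hsq
  obtain ⟨a, -, huniq⟩ := hreg 0 h0 0 h0
  have hππ : π * π = 1 := by
    have e1 := huniq _ ⟨hsq, by rw [zero_add]; rfl⟩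
    have e2 := huniq _ ⟨hone, by rw [zero_add]; rfl⟩
    exact congrArg Prod.snd (e1.trans e2.symm)
  refine h1 ?_
  rw [← extCol_symm e, hgcol, hgcol, Option.map_map]
  have : π ∘ π = id := congrArg (fun σ : Equiv.Perm ι => (σ : ι → ι)) hππ
  rw [this, Option.map_id, id]

end Extension

/-- for every `n = 2^k - 1` with `n ≥ 15` there is a reduced perfect binary
code of length `n` that is transitive but not propelinear. -/
theorem stmt1 (n k : ℕ) (hk : n + 1 = 2 ^ k) (hn : 15 ≤ n) :
    ∃ C : Set (F (Fin n)), (0 : F (Fin n)) ∈ C ∧ IsPerfect C ∧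
      IsTransitive C ∧ ¬ IsPropelinear C := by
  have hk4 : 4 ≤ k := by
    by_contra hlt
    have : 2 ^ k ≤ 2 ^ 3 := Nat.pow_le_pow_right (by norm_num) (by omega)
    omega
  obtain ⟨s, rfl⟩ := Nat.exists_eq_add_of_le hk4
  have hcard : Fintype.card (Option (Fin n)) = Fintype.card (Fin 16 × F (Fin s)) := by
    simp [hk, pow_add]
  let e₀ := Fintype.equivOfCardEq hcard
  let e := e₀.setValue none (0, 0)
  have he : e none = (0, 0) := Equiv.setValue_eq _ _ _
  refine ⟨syndromeCode (extCol e) (extSynSet (F (Fin s))), ?_,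
    isPerfect_syndromeCode (extCol_none e he) (existsUnique_add_extCol_mem e he),
    isTransitive_syndromeCode e he, not_isPropelinear_syndromeCode e he⟩
  rw [mem_syndromeCode, map_zero]
  exact ⟨zero_mem_synSet, rfl⟩
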